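/- Three-term recurrence relation for the rational functions of Hahn type: for every integer n with 1 ≤ n ≤ N − 1 and every integer x, μ₁ U_{n+1}(x;α,β,N) + μ₂ U_n(x;α,β,N) + μ₃ U_{n−1}(x;α,β,N) = (α − x) · (μ₇ U_{n+1}(x;α,β,N) + μ₈ U_n(x;α,β,N) + μ₉ U_{n−1}(x;α,β,N)), where μ₁ = n(β+n+1)(N−β−n)/((N−β−2n)(N−β−2n−1)), μ₂ = −α − n + (βn(n−1) + n²(n−1))/(N−β−2n+1) − (βn(n+1) + n(n+1)²)/(N−β−2n−1), μ₃ = n(N−β−n)(N−n+1)/((N−β−2n)(N−β−2n+1)), μ₇ = −(β+n+1)(N−β−n)/((N−β−2n)(N−β−2n−1)), μ₈ = ((n+1)β + (n+1)²)/(N−β−2n−1) − (βn + n²)/(N−β−2n+1), and μ₉ = −n(N−n+1)/((N−β−2n)(N−β−2n+1)). -/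

import Mathlib

/-- Pochhammer symbol `(a)_k = a (a+1) ⋯ (a+k-1)`, with `(a)_0 = 1`. -/
noncomputable def poch (a : ℝ) (k : ℕ) : ℝ := ∏ i ∈ Finset.range k, (a + (i : ℝ))

/-- The rational function of Hahn type `U_n(x;α,β,N)`. -/
noncomputable def U (α β : ℝ) (N n : ℕ) (x : ℤ) : ℝ :=
  ((-1 : ℝ) ^ n * poch (-(N : ℝ)) n / poch (β + 1) n) *
    ∑ k ∈ Finset.range (n + 1),
      poch (-(x : ℝ)) k * poch (-(n : ℝ)) k * poch (β + (n : ℝ) - (N : ℝ)) k /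
        ((Nat.factorial k : ℝ) * poch (-(N : ℝ)) k * poch (α - (x : ℝ)) k)

/-- Recurrence coefficients. -/
noncomputable def mu1 (α β : ℝ) (N n : ℕ) : ℝ :=
  (n : ℝ) * (β + (n : ℝ) + 1) * ((N : ℝ) - β - (n : ℝ)) /
    (((N : ℝ) - β - 2 * (n : ℝ)) * ((N : ℝ) - β - 2 * (n : ℝ) - 1))

noncomputable def mu2 (α β : ℝ) (N n : ℕ) : ℝ :=
  -α - (n : ℝ)
    + (β * (n : ℝ) * ((n : ℝ) - 1) + (n : ℝ) ^ 2 * ((n : ℝ) - 1)) /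
        ((N : ℝ) - β - 2 * (n : ℝ) + 1)
    - (β * (n : ℝ) * ((n : ℝ) + 1) + (n : ℝ) * ((n : ℝ) + 1) ^ 2) /
        ((N : ℝ) - β - 2 * (n : ℝ) - 1)

noncomputable def mu3 (α β : ℝ) (N n : ℕ) : ℝ :=
  (n : ℝ) * ((N : ℝ) - β - (n : ℝ)) * ((N : ℝ) - (n : ℝ) + 1) /
    (((N : ℝ) - β - 2 * (n : ℝ)) * ((N : ℝ) - β - 2 * (n : ℝ) + 1))

noncomputable def mu7 (α β : ℝ) (N n : ℕ) : ℝ :=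
  -((β + (n : ℝ) + 1) * ((N : ℝ) - β - (n : ℝ))) /
    (((N : ℝ) - β - 2 * (n : ℝ)) * ((N : ℝ) - β - 2 * (n : ℝ) - 1))

noncomputable def mu8 (α β : ℝ) (N n : ℕ) : ℝ :=
  (((n : ℝ) + 1) * β + ((n : ℝ) + 1) ^ 2) / ((N : ℝ) - β - 2 * (n : ℝ) - 1)
    - (β * (n : ℝ) + (n : ℝ) ^ 2) / ((N : ℝ) - β - 2 * (n : ℝ) + 1)

noncomputable def mu9 (α β : ℝ) (N n : ℕ) : ℝ :=
  -((n : ℝ) * ((N : ℝ) - (n : ℝ) + 1)) /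
    (((N : ℝ) - β - 2 * (n : ℝ)) * ((N : ℝ) - β - 2 * (n : ℝ) + 1))

theorem poch_succ (a : ℝ) (k : ℕ) : poch a (k + 1) = poch a k * (a + k) := by
  simp [poch, Finset.prod_range_succ]

theorem poch_succ' (a : ℝ) (k : ℕ) : poch a (k + 1) = a * poch (a + 1) k := by
  simp only [poch, Finset.prod_range_succ', Nat.cast_zero, add_zero, Nat.cast_add, Nat.cast_one]
  rw [mul_comm]
  congr 1
  exact Finset.prod_congr rfl fun i _ => by ring

theorem poch_neg_eq_zero {n k : ℕ} (h : n < k) : poch (-(n : ℝ)) k = 0 :=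
  Finset.prod_eq_zero (Finset.mem_range.2 h) (by simp)

/-- The prefactor of `U`. -/
noncomputable def hahnPrefactor (β : ℝ) (N n : ℕ) : ℝ :=
  (-1 : ℝ) ^ n * poch (-(N : ℝ)) n / poch (β + 1) n

/-- The part of the `k`-th summand of `U` that depends on `n`. -/
noncomputable def hahnCoeff (β : ℝ) (N n k : ℕ) : ℝ :=
  hahnPrefactor β N n * (poch (-(n : ℝ)) k * poch (β + (n : ℝ) - (N : ℝ)) k)

/-- The part of the `k`-th summand of `U` that does not depend on `n`. -/
noncomputable def hahnBasis (α : ℝ) (N : ℕ) (x : ℤ) (k : ℕ) : ℝ :=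
  poch (-(x : ℝ)) k / ((Nat.factorial k : ℝ) * poch (-(N : ℝ)) k * poch (α - (x : ℝ)) k)

theorem U_eq_sum (α β : ℝ) (N : ℕ) {n M : ℕ} (x : ℤ) (h : n < M) :
    U α β N n x = ∑ k ∈ Finset.range M, hahnCoeff β N n k * hahnBasis α N x k := by
  have hs : Finset.range (n + 1) ⊆ Finset.range M := Finset.range_subset_range.2 h
  rw [← Finset.sum_subset hs, U, Finset.mul_sum]
  · refine Finset.sum_congr rfl fun k _ => ?_
    simp only [hahnCoeff, hahnBasis, hahnPrefactor]
    ring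
  · intro k _ hk
    rw [Finset.mem_range, not_lt] at hk
    simp [hahnCoeff, poch_neg_eq_zero (Nat.lt_of_succ_le hk)]

theorem hahnPrefactor_succ (β : ℝ) (N n : ℕ) :
    hahnPrefactor β N (n + 1) = hahnPrefactor β N n * (((N : ℝ) - n) / (β + n + 1)) := by
  simp only [hahnPrefactor, poch_succ, pow_succ, div_eq_mul_inv, mul_inv]
  rw [show β + 1 + (n : ℝ) = β + n + 1 by ring]
  ring

theorem hahnBasis_succ (α : ℝ) {N : ℕ} (x : ℤ) {k : ℕ} (hN : k < N)
    (hα : α - (x : ℝ) + k ≠ 0) :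
    hahnBasis α N x k * (k - x) =
      hahnBasis α N x (k + 1) * ((k + 1) * (k - N) * (α - x + k)) := by
  have h1 : -(N : ℝ) + k ≠ 0 := by
    have : (k : ℝ) < N := by exact_mod_cast hN
    linarith
  have h2 : (k : ℝ) + 1 ≠ 0 := by positivity
  simp only [hahnBasis, poch_succ, Nat.factorial_succ, Nat.cast_mul, Nat.cast_add, Nat.cast_one,
    div_eq_mul_inv, mul_inv]
  field_simp
  ring

theorem add_intCast_ne_zero {a : ℝ} (ha : ∀ m : ℤ, a ≠ (m : ℝ)) (m : ℤ) : a + m ≠ 0 :=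
  fun h => ha (-m) (by push_cast; linarith)

/-- The three coefficients `hahnCoeff β N · (k + 1)` of adjacent degrees `n + 2`, `n + 1`, `n`,
expressed through the factors of `hahnCoeff β N (n + 1) k`. -/
theorem hahnCoeff_adjacent {β : ℝ} (hβ : ∀ m : ℤ, β ≠ (m : ℝ)) {N n : ℕ} (hn : n < N) (k : ℕ) :
    hahnCoeff β N (n + 2) (k + 1) = hahnCoeff β N (n + 1) k *
      ((N - (n + 1)) / (β + n + 2) * (-(n + 2)) *
        ((β + n + 1 - N + k) * (β + n + 1 - N + k + 1) / (β + n + 1 - N))) ∧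
    hahnCoeff β N (n + 1) (k + 1) = hahnCoeff β N (n + 1) k *
      ((k - (n + 1)) * (β + n + 1 - N + k)) ∧
    hahnCoeff β N n (k + 1) = hahnCoeff β N (n + 1) k *
      ((β + n + 1) / (N - n) * ((k - (n + 1)) * (k - n) / (-(n + 1))) * (β + n - N)) := by
  have h1 : β + n + 1 - N ≠ 0 := by
    convert add_intCast_ne_zero hβ (n + 1 - N) using 1
    push_cast
    ring
  have h2 : β + n + 1 ≠ 0 := by
    convert add_intCast_ne_zero hβ (n + 1) using 1
    push_cast
    ring
  have h3 : (N : ℝ) - n ≠ 0 := by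
    have : (n : ℝ) < N := by exact_mod_cast hn
    linarith
  have h4 : (n : ℝ) + 1 ≠ 0 := by positivity
  refine ⟨?_, ?_, ?_⟩
  · have e1 : poch (-((n + 2 : ℕ) : ℝ)) (k + 1) =
        -(n + 2) * poch (-((n + 1 : ℕ) : ℝ)) k := by
      rw [poch_succ']
      push_cast
      ring_nf
    have e2 : poch (β + ((n + 2 : ℕ) : ℝ) - N) (k + 1) =
        poch (β + ((n + 1 : ℕ) : ℝ) - N) k *
          ((β + n + 1 - N + k) * (β + n + 1 - N + k + 1) / (β + n + 1 - N)) := by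
      have e := poch_succ' (β + ((n + 1 : ℕ) : ℝ) - N) (k + 1)
      rw [poch_succ, poch_succ] at e
      push_cast at e ⊢
      rw [show β + ((n : ℝ) + 1) - N + 1 = β + (n + 2) - N by ring] at e
      field_simp
      linear_combination -e
    simp only [hahnCoeff, e1, e2, hahnPrefactor_succ β N (n + 1)]
    push_cast
    rw [show β + ((n : ℝ) + 1) + 1 = β + n + 2 by ring]
    ring
  · simp only [hahnCoeff, poch_succ]
    push_cast
    ring
  · have e1 : poch (-(n : ℝ)) (k + 1) =
        poch (-((n + 1 : ℕ) : ℝ)) k * ((k - (n + 1)) * (k - n) / (-(n + 1))) := by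
      have e := poch_succ' (-((n + 1 : ℕ) : ℝ)) (k + 1)
      rw [poch_succ, poch_succ] at e
      push_cast at e ⊢
      rw [show -((n : ℝ) + 1) + 1 = -n by ring] at e
      field_simp
      linear_combination e
    have e2 : poch (β + (n : ℝ) - N) (k + 1) =
        (β + n - N) * poch (β + ((n + 1 : ℕ) : ℝ) - N) k := by
      rw [poch_succ']
      push_cast
      ring_nf
    simp only [hahnCoeff, e1, e2, hahnPrefactor_succ β N n]
    field_simp

theorem substitution_ne_zero {β m s d : ℝ} (hβ : ∀ j : ℤ, β ≠ (j : ℝ)) {N n : ℕ} (hn : n < N)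
    (hm : (n : ℝ) = m - 1) (hs : β = s - m) (hd : (N : ℝ) = d + s + m) :
    s + 1 ≠ 0 ∧ d + s + 1 ≠ 0 ∧ d ≠ 0 ∧ d - 1 ≠ 0 ∧ d + 1 ≠ 0 ∧ m ≠ 0 ∧ d + m ≠ 0 ∧ s ≠ 0 := by
  have g : ∀ j : ℤ, β + j ≠ 0 := add_intCast_ne_zero hβ
  have h1 : s + 1 ≠ 0 := by
    convert g (n + 2) using 1
    push_cast
    linarith
  have h2 : d + s + 1 ≠ 0 := by
    have : (n : ℝ) < N := by exact_mod_cast hn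
    linarith
  have h3 : d ≠ 0 := by
    convert neg_ne_zero.2 (g (2 * n + 2 - N)) using 1
    push_cast
    linarith
  have h4 : d - 1 ≠ 0 := by
    convert neg_ne_zero.2 (g (2 * n + 3 - N)) using 1
    push_cast
    linarith
  have h5 : d + 1 ≠ 0 := by
    convert neg_ne_zero.2 (g (2 * n + 1 - N)) using 1
    push_cast
    linarith
  have h6 : m ≠ 0 := by
    have : (0 : ℝ) ≤ n := n.cast_nonneg
    linarith
  have h7 : d + m ≠ 0 := by
    convert neg_ne_zero.2 (g (n + 1 - N)) using 1
    push_cast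
    linarith
  have h8 : s ≠ 0 := by
    convert g (n + 1) using 1
    push_cast
    linarith
  exact ⟨h1, h2, h3, h4, h5, h6, h7, h8⟩

/-- The recurrence coefficients in the variables `m = n + 1`, `s = β + m`, `d = N - s - m`. -/
theorem mu_substitution {α β m s d : ℝ} {N n : ℕ} (hm : (n : ℝ) = m - 1) (hs : β = s - m)
    (hd : (N : ℝ) = d + s + m) :
    mu1 α β N (n + 1) = m * (s + 1) * (d + m) / (d * (d - 1)) ∧
    mu2 α β N (n + 1) =
      -α - m + m * (m - 1) * s / (d + 1) - m * (m + 1) * (s + 1) / (d - 1) ∧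
    mu3 α β N (n + 1) = m * (d + m) * (d + s + 1) / (d * (d + 1)) ∧
    mu7 α β N (n + 1) = -((s + 1) * (d + m)) / (d * (d - 1)) ∧
    mu8 α β N (n + 1) = (m + 1) * (s + 1) / (d - 1) - m * s / (d + 1) ∧
    mu9 α β N (n + 1) = -(m * (d + s + 1)) / (d * (d + 1)) := by
  simp only [mu1, mu2, mu3, mu7, mu8, mu9, Nat.cast_add, Nat.cast_one, hm, hd]
  subst hs
  refine ⟨?_, ?_, ?_, ?_, ?_, ?_⟩ <;> ring_nf

/-- Both sides of the recurrence, without the factor `α - x`, compared on the basis function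
of index `k + 1`. -/
theorem hahnCoeff_recurrence (α : ℝ) {β : ℝ} (hβ : ∀ m : ℤ, β ≠ (m : ℝ)) {N n : ℕ} (hn : n < N)
    (k : ℕ) :
    mu1 α β N (n + 1) * hahnCoeff β N (n + 2) (k + 1)
        + mu2 α β N (n + 1) * hahnCoeff β N (n + 1) (k + 1)
        + mu3 α β N (n + 1) * hahnCoeff β N n (k + 1) =
      -(hahnCoeff β N (n + 1) (k + 1) * (α - (k + 1)))
        - hahnCoeff β N (n + 1) k * (k * (k + 1) * (k - N)) ∧
    mu7 α β N (n + 1) * hahnCoeff β N (n + 2) (k + 1)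
        + mu8 α β N (n + 1) * hahnCoeff β N (n + 1) (k + 1)
        + mu9 α β N (n + 1) * hahnCoeff β N n (k + 1) =
      -hahnCoeff β N (n + 1) (k + 1)
        + hahnCoeff β N (n + 1) k * ((k + 1) * (k - N)) := by
  obtain ⟨e1, e2, e3⟩ := hahnCoeff_adjacent hβ hn k
  rw [e1, e2, e3]
  generalize hahnCoeff β N (n + 1) k = c
  obtain ⟨m, hm⟩ : ∃ m : ℝ, (n : ℝ) = m - 1 := ⟨n + 1, by ring⟩
  obtain ⟨s, hs⟩ : ∃ s : ℝ, β = s - m := ⟨β + m, by ring⟩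
  obtain ⟨d, hd⟩ : ∃ d : ℝ, (N : ℝ) = d + s + m := ⟨N - s - m, by ring⟩
  obtain ⟨h1, h2, h3, h4, h5, h6, h7, h8⟩ := substitution_ne_zero hβ hn hm hs hd
  obtain ⟨m1, m2, m3, m7, m8, m9⟩ := mu_substitution (α := α) hm hs hd
  rw [m1, m2, m3, m7, m8, m9, hm, hd, hs]
  rw [show s - m + (m - 1) + 2 = s + 1 by ring, show s - m + (m - 1) + 1 = s by ring,
    show s - (d + s + m) = -(d + m) by ring, show d + s + m - (m - 1 + 1) = d + s by ring,
    show d + s + m - (m - 1) = d + s + 1 by ring, show m - 1 + 1 = m by ring]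
  constructor
  · field_simp
    ring
  · field_simp
    ring

theorem hahnCoeff_recurrence_zero (α : ℝ) {β : ℝ} (hβ : ∀ m : ℤ, β ≠ (m : ℝ)) {N n : ℕ}
    (hn : n < N) :
    mu1 α β N (n + 1) * hahnCoeff β N (n + 2) 0 + mu2 α β N (n + 1) * hahnCoeff β N (n + 1) 0
        + mu3 α β N (n + 1) * hahnCoeff β N n 0 = -(hahnCoeff β N (n + 1) 0 * α) ∧
    mu7 α β N (n + 1) * hahnCoeff β N (n + 2) 0 + mu8 α β N (n + 1) * hahnCoeff β N (n + 1) 0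
        + mu9 α β N (n + 1) * hahnCoeff β N n 0 = -hahnCoeff β N (n + 1) 0 := by
  have e (j : ℕ) : hahnCoeff β N j 0 = hahnPrefactor β N j := by simp [hahnCoeff, poch]
  simp only [e, hahnPrefactor_succ β N (n + 1), hahnPrefactor_succ β N n]
  generalize hahnPrefactor β N n = c
  obtain ⟨m, hm⟩ : ∃ m : ℝ, (n : ℝ) = m - 1 := ⟨n + 1, by ring⟩
  obtain ⟨s, hs⟩ : ∃ s : ℝ, β = s - m := ⟨β + m, by ring⟩
  obtain ⟨d, hd⟩ : ∃ d : ℝ, (N : ℝ) = d + s + m := ⟨N - s - m, by ring⟩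
  obtain ⟨h1, h2, h3, h4, h5, h6, h7, h8⟩ := substitution_ne_zero hβ hn hm hs hd
  obtain ⟨m1, m2, m3, m7, m8, m9⟩ := mu_substitution (α := α) hm hs hd
  rw [m1, m2, m3, m7, m8, m9]
  push_cast
  rw [hm, hd, hs]
  rw [show d + s + m - (m - 1 + 1) = d + s by ring, show s - m + (m - 1 + 1) + 1 = s + 1 by ring,
    show d + s + m - (m - 1) = d + s + 1 by ring, show s - m + (m - 1) + 1 = s by ring]
  constructor
  · field_simp
    ring
  · field_simp
    ring

theorem statement13 (N : ℕ) (hN : 0 < N) (α β : ℝ)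
    (hα : ∀ m : ℤ, α ≠ (m : ℝ)) (hβ : ∀ m : ℤ, β ≠ (m : ℝ))
    (n : ℕ) (hn1 : 1 ≤ n) (hn2 : n + 1 ≤ N) (x : ℤ) :
    mu1 α β N n * U α β N (n + 1) x + mu2 α β N n * U α β N n x
        + mu3 α β N n * U α β N (n - 1) x =
      (α - (x : ℝ)) *
        (mu7 α β N n * U α β N (n + 1) x + mu8 α β N n * U α β N n x
          + mu9 α β N n * U α β N (n - 1) x) := by
  obtain ⟨n, rfl⟩ := Nat.exists_eq_add_of_le' hn1
  have hnN : n < N := by omega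
  rw [Nat.add_sub_cancel, U_eq_sum α β N (M := n + 3) x (by omega),
    U_eq_sum α β N (n := n + 1) (M := n + 3) x (by omega),
    U_eq_sum α β N (n := n) (M := n + 3) x (by omega), ← sub_eq_zero]
  have partial_sum : ∀ m ≤ n + 2,
      ∑ k ∈ Finset.range (m + 1),
        ((mu1 α β N (n + 1) * hahnCoeff β N (n + 2) k
            + mu2 α β N (n + 1) * hahnCoeff β N (n + 1) k
            + mu3 α β N (n + 1) * hahnCoeff β N n k)
          - (α - x) * (mu7 α β N (n + 1) * hahnCoeff β N (n + 2) k
            + mu8 α β N (n + 1) * hahnCoeff β N (n + 1) k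
            + mu9 α β N (n + 1) * hahnCoeff β N n k)) * hahnBasis α N x k =
        hahnCoeff β N (n + 1) m * hahnBasis α N x m * (m - x) := by
    intro m
    induction m with
    | zero =>
      intro _
      obtain ⟨e1, e2⟩ := hahnCoeff_recurrence_zero α hβ hnN
      rw [Finset.sum_range_one, e1, e2]
      push_cast
      ring
    | succ m ih =>
      intro hm
      obtain ⟨e1, e2⟩ := hahnCoeff_recurrence α hβ hnN m
      have hα' : α - (x : ℝ) + m ≠ 0 := by
        convert add_intCast_ne_zero hα (m - x) using 1
        push_cast
        ring
      have e3 := hahnBasis_succ α x (by omega : m < N) hα'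
      rw [Finset.sum_range_succ, ih (by omega), e1, e2]
      push_cast
      linear_combination hahnCoeff β N (n + 1) m * e3
  have key := partial_sum (n + 2) le_rfl
  rw [show hahnCoeff β N (n + 1) (n + 2) = 0 by
    simp only [hahnCoeff, poch_neg_eq_zero (Nat.lt_succ_self (n + 1)), zero_mul, mul_zero],
    zero_mul, zero_mul] at key
  rw [← key]
  simp only [sub_mul, add_mul, mul_add, Finset.sum_sub_distrib, Finset.sum_add_distrib,
    Finset.mul_sum]
  simp only [mul_assoc]
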